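/- An indefinite even unimodular lattice of signature 0 and rank 2n is isomorphic to the orthogonal direct sum of n copies of the hyperbolic plane H. -/

import Mathlib

open Matrix

/-- The Gram matrix of the orthogonal direct sum of `n` copies of the hyperbolic plane
`H` (Gram matrix `[[0,1],[1,0]]`): the pairs `(2k, 2k+1)` are hyperbolic pairs. -/
def hyperbolicSum (n : ℕ) : Matrix (Fin (2 * n)) (Fin (2 * n)) ℤ :=
  fun i j => if (i : ℕ) / 2 = (j : ℕ) / 2 ∧ (i : ℕ) ≠ (j : ℕ) then 1 else 0

namespace WittClassification

open Module

/-- A bilinear form is metabolic when it vanishes on a subspace of at least half the dimension. -/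
def IsMetabolic {K V : Type*} [Field K] [AddCommGroup V] [Module K V]
    (B : LinearMap.BilinForm K V) : Prop :=
  ∃ U : Submodule K V, (∀ x ∈ U, ∀ y ∈ U, B x y = 0) ∧ finrank K V ≤ 2 * finrank K U

/-- The orthogonal direct sum of two bilinear forms. -/
def prodForm {K V W : Type*} [Field K] [AddCommGroup V] [Module K V] [AddCommGroup W] [Module K W]
    (B : LinearMap.BilinForm K V) (C : LinearMap.BilinForm K W) :
    LinearMap.BilinForm K (V × W) :=
  B.compl₁₂ (LinearMap.fst K V W) (LinearMap.fst K V W) +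
    C.compl₁₂ (LinearMap.snd K V W) (LinearMap.snd K V W)

section Forms

variable {K V W : Type*} [Field K] [AddCommGroup V] [Module K V] [AddCommGroup W] [Module K W]
  {B : LinearMap.BilinForm K V} {C : LinearMap.BilinForm K W}

@[simp]
theorem prodForm_apply (x y : V × W) : prodForm B C x y = B x.1 y.1 + C x.2 y.2 := rfl

theorem prodForm_isSymm (hB : B.IsSymm) (hC : C.IsSymm) : (prodForm B C).IsSymm :=
  ⟨fun x y => by simp [hB.eq x.1, hC.eq x.2]⟩

theorem nondegenerate_of_isSymm (hB : B.IsSymm) (h : ∀ x, (∀ y, B x y = 0) → x = 0) :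
    B.Nondegenerate :=
  ⟨h, fun y hy => h y fun x => by rw [hB.eq]; exact hy x⟩

theorem prodForm_nondegenerate (hB : B.IsSymm) (hC : C.IsSymm) (hB' : B.Nondegenerate)
    (hC' : C.Nondegenerate) : (prodForm B C).Nondegenerate := by
  refine nondegenerate_of_isSymm (prodForm_isSymm hB hC) fun x hx => Prod.ext ?_ ?_
  · exact hB'.1 _ fun y => by simpa using hx (y, 0)
  · exact hC'.1 _ fun y => by simpa using hx (0, y)

theorem IsMetabolic.neg (h : IsMetabolic B) : IsMetabolic (-B) := by
  obtain ⟨U, hU, hd⟩ := h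
  exact ⟨U, fun x hx y hy => by simp [hU x hx y hy], hd⟩

theorem IsMetabolic.of_equiv (h : IsMetabolic B) (e : V ≃ₗ[K] W)
    (he : ∀ x y, C (e x) (e y) = B x y) : IsMetabolic C := by
  obtain ⟨U, hU, hd⟩ := h
  refine ⟨U.map e.toLinearMap, ?_, ?_⟩
  · rintro _ ⟨x, hx, rfl⟩ _ ⟨y, hy, rfl⟩
    simpa [he] using hU x hx y hy
  · rw [← e.finrank_eq, LinearEquiv.finrank_map_eq]
    exact hd

variable [FiniteDimensional K V] [FiniteDimensional K W]

theorem two_mul_finrank_le (hB : B.Nondegenerate) {U : Submodule K V}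
    (hU : ∀ x ∈ U, ∀ y ∈ U, B x y = 0) : 2 * finrank K U ≤ finrank K V := by
  have h1 : U ≤ B.orthogonal U := fun y hy x hx => hU x hx y hy
  have h2 := Submodule.finrank_mono h1
  rw [LinearMap.BilinForm.finrank_orthogonal hB] at h2
  have := U.finrank_le
  omega

theorem orthogonal_eq_self (hB : B.Nondegenerate) {U : Submodule K V}
    (hU : ∀ x ∈ U, ∀ y ∈ U, B x y = 0) (hd : finrank K V = 2 * finrank K U) :
    B.orthogonal U = U := by
  have hle : U ≤ B.orthogonal U := fun y hy x hx => hU x hx y hy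
  refine (Submodule.eq_of_le_of_finrank_eq hle ?_).symm
  rw [LinearMap.BilinForm.finrank_orthogonal hB]
  omega

theorem finrank_submodule_prod (U : Submodule K V) (U' : Submodule K W) :
    finrank K (U.prod U') = finrank K U + finrank K U' := by
  let e : (U.prod U') ≃ₗ[K] U × U' :=
    { toFun := fun x => (⟨x.1.1, x.2.1⟩, ⟨x.1.2, x.2.2⟩)
      invFun := fun x => ⟨(x.1, x.2), x.1.2, x.2.2⟩
      map_add' := fun _ _ => rfl
      map_smul' := fun _ _ => rfl }
  rw [e.finrank_eq, finrank_prod]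

theorem IsMetabolic.prod (hB : IsMetabolic B) (hC : IsMetabolic C) :
    IsMetabolic (prodForm B C) := by
  obtain ⟨U, hU, hd⟩ := hB
  obtain ⟨U', hU', hd'⟩ := hC
  refine ⟨U.prod U', fun x hx y hy => ?_, ?_⟩
  · simp [hU _ hx.1 _ hy.1, hU' _ hx.2 _ hy.2]
  · rw [finrank_submodule_prod, finrank_prod]
    omega

theorem isMetabolic_prodForm_neg_of_equiv (e : V ≃ₗ[K] W) (he : ∀ x y, C (e x) (e y) = B x y) :
    IsMetabolic (prodForm B (-C)) := by
  refine ⟨(LinearMap.prod LinearMap.id e.toLinearMap).range, ?_, ?_⟩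
  · rintro _ ⟨x, rfl⟩ _ ⟨y, rfl⟩
    simp [he]
  · rw [LinearMap.finrank_range_of_inj fun x y h => congrArg Prod.fst h, finrank_prod,
      e.finrank_eq]
    omega

/-- Witt cancellation for metabolic forms. -/
theorem IsMetabolic.of_prod (hBs : B.IsSymm) (hCs : C.IsSymm) (hBn : B.Nondegenerate)
    (hCn : C.Nondegenerate) (h : IsMetabolic (prodForm B C)) (hC : IsMetabolic C) :
    IsMetabolic B := by
  obtain ⟨L, hL, hLd⟩ := h
  obtain ⟨U, hU, hUd⟩ := hC
  rw [finrank_prod] at hLd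
  have hn := prodForm_nondegenerate hBs hCs hBn hCn
  set N : Submodule K (V × W) := L ⊓ (⊤ : Submodule K V).prod U with hN
  set Z : Submodule K (V × W) := (⊥ : Submodule K V).prod U with hZ
  have hZd : finrank K Z = finrank K U := by
    rw [hZ, finrank_submodule_prod]; simp
  have hU2 := two_mul_finrank_le hCn hU
  have hL2 := two_mul_finrank_le hn hL
  rw [finrank_prod] at hL2
  have hsub : (prodForm B C).orthogonal (L ⊔ Z) ≤ N := by
    intro x hx
    constructor
    · rw [← orthogonal_eq_self hn hL (by rw [finrank_prod]; omega)]
      exact fun y hy => hx y (Submodule.mem_sup_left hy)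
    · refine ⟨trivial, ?_⟩
      rw [← orthogonal_eq_self hCn hU (by omega)]
      intro y hy
      have : prodForm B C (0, y) x = 0 := hx (0, y) (Submodule.mem_sup_right ⟨rfl, hy⟩)
      simpa using this
  have hNd := Submodule.finrank_mono hsub
  rw [LinearMap.BilinForm.finrank_orthogonal hn, finrank_prod] at hNd
  have hsup := Submodule.finrank_sup_add_finrank_inf_eq L Z
  have hle := (L ⊔ Z).finrank_le
  rw [finrank_prod] at hle
  set g : N →ₗ[K] V := LinearMap.fst K V W ∘ₗ N.subtype
  have hrk := g.finrank_range_add_finrank_ker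
  have hker : finrank K g.ker ≤ finrank K (L ⊓ Z : Submodule K (V × W)) := by
    rw [← N.finrank_map_subtype_eq]
    apply Submodule.finrank_mono
    rintro _ ⟨x, hx, rfl⟩
    exact ⟨x.2.1, hx, x.2.2.2⟩
  refine ⟨g.range, ?_, by omega⟩
  rintro _ ⟨x, rfl⟩ _ ⟨y, rfl⟩
  have := hL _ x.2.1 _ y.2.1
  rw [prodForm_apply, hU _ x.2.2.2 _ y.2.2.2, add_zero] at this
  exact this

end Forms

/-- A finite-dimensional space with a nondegenerate symmetric bilinear form. -/
structure SymmSpace (K : Type) [Field K] where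
  /-- the underlying vector space -/
  V : Type
  [addCommGroup : AddCommGroup V]
  [module : Module K V]
  [finiteDimensional : FiniteDimensional K V]
  /-- the bilinear form -/
  B : LinearMap.BilinForm K V
  isSymm : B.IsSymm
  nondegenerate : B.Nondegenerate

attribute [instance] SymmSpace.addCommGroup SymmSpace.module SymmSpace.finiteDimensional

namespace SymmSpace

variable {K : Type} [Field K]

/-- Orthogonal direct sum. -/
def sum (X Y : SymmSpace K) : SymmSpace K where
  V := X.V × Y.V
  B := prodForm X.B Y.B
  isSymm := prodForm_isSymm X.isSymm Y.isSymm
  nondegenerate := prodForm_nondegenerate X.isSymm Y.isSymm X.nondegenerate Y.nondegenerate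

/-- The same space with the opposite form. -/
def opp (X : SymmSpace K) : SymmSpace K where
  V := X.V
  B := -X.B
  isSymm := ⟨fun x y => by simp [X.isSymm.eq x]⟩
  nondegenerate := nondegenerate_of_isSymm ⟨fun x y => by simp [X.isSymm.eq x]⟩
    fun x hx => X.nondegenerate.1 x fun y => by simpa using hx y

/-- The zero space. -/
def zero (K : Type) [Field K] : SymmSpace K where
  V := PUnit
  B := 0
  isSymm := ⟨fun _ _ => rfl⟩
  nondegenerate := nondegenerate_of_isSymm ⟨fun _ _ => rfl⟩ fun _ _ => rfl

/-- Metabolic spaces. -/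
def Met (X : SymmSpace K) : Prop := IsMetabolic X.B

theorem Met.of_equiv {X Y : SymmSpace K} (h : X.Met) (e : X.V ≃ₗ[K] Y.V)
    (he : ∀ x y, Y.B (e x) (e y) = X.B x y) : Y.Met :=
  IsMetabolic.of_equiv h e he

theorem Met.sum {X Y : SymmSpace K} (hX : X.Met) (hY : Y.Met) : (X.sum Y).Met :=
  IsMetabolic.prod hX hY

theorem Met.of_sum {X Y : SymmSpace K} (h : (X.sum Y).Met) (hY : Y.Met) : X.Met :=
  IsMetabolic.of_prod X.isSymm Y.isSymm X.nondegenerate Y.nondegenerate h hY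

theorem met_sum_opp_of_equiv {X Y : SymmSpace K} (e : X.V ≃ₗ[K] Y.V)
    (he : ∀ x y, Y.B (e x) (e y) = X.B x y) : (X.sum Y.opp).Met :=
  isMetabolic_prodForm_neg_of_equiv e he

/-- Witt equivalence. -/
instance wittSetoid (K : Type) [Field K] : Setoid (SymmSpace K) where
  r X Y := (X.sum Y.opp).Met
  iseqv :=
    { refl := fun X => met_sum_opp_of_equiv (LinearEquiv.refl K X.V) fun _ _ => rfl
      symm := fun {X Y} h => by
        have h' : (X.sum Y.opp).opp.Met := IsMetabolic.neg h
        refine h'.of_equiv (Y := Y.sum X.opp) (LinearEquiv.prodComm K X.V Y.V) fun x y => ?_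
        change Y.B x.2 y.2 + -X.B x.1 y.1 = -(X.B x.1 y.1 + -Y.B x.2 y.2)
        ring
      trans := fun {X Y Z} h h' => by
        refine Met.of_sum (X := X.sum Z.opp) (Y := Y.sum Y.opp) ?_
          (met_sum_opp_of_equiv (LinearEquiv.refl K Y.V) fun _ _ => rfl)
        refine (h.sum h').of_equiv
          (LinearEquiv.mk { toFun := fun v => ((v.1.1, v.2.2), (v.2.1, v.1.2)),
                            map_add' := fun _ _ => rfl, map_smul' := fun _ _ => rfl }
            (fun v => ((v.1.1, v.2.2), (v.2.1, v.1.2))) (fun _ => rfl) (fun _ => rfl)) ?_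
        intro x y
        change X.B x.1.1 y.1.1 + -Z.B x.2.2 y.2.2 + (Y.B x.2.1 y.2.1 + -Y.B x.1.2 y.1.2) =
          X.B x.1.1 y.1.1 + -Y.B x.1.2 y.1.2 + (Y.B x.2.1 y.2.1 + -Z.B x.2.2 y.2.2)
        ring }

theorem equiv_of_isometry {X Y : SymmSpace K} (e : X.V ≃ₗ[K] Y.V)
    (he : ∀ x y, Y.B (e x) (e y) = X.B x y) : X ≈ Y :=
  met_sum_opp_of_equiv e he

end SymmSpace

/-- The Witt group of symmetric bilinear forms. -/
def WittGroup (K : Type) [Field K] : Type 1 := Quotient (SymmSpace.wittSetoid K)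

namespace WittGroup

variable {K : Type} [Field K]

/-- The Witt class of a space. -/
def mk (X : SymmSpace K) : WittGroup K := Quotient.mk _ X

theorem mk_eq_of_isometry {X Y : SymmSpace K} (e : X.V ≃ₗ[K] Y.V)
    (he : ∀ x y, Y.B (e x) (e y) = X.B x y) : mk X = mk Y :=
  Quotient.sound (SymmSpace.equiv_of_isometry e he)

instance : Zero (WittGroup K) := ⟨mk (SymmSpace.zero K)⟩

instance : Add (WittGroup K) :=
  ⟨Quotient.map₂ SymmSpace.sum fun X X' h Y Y' h' => by
    refine SymmSpace.Met.of_equiv (SymmSpace.Met.sum h h')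
      (LinearEquiv.prodProdProdComm K X.V X'.V Y.V Y'.V) fun x y => ?_
    change X.B x.1.1 y.1.1 + Y.B x.2.1 y.2.1 + -(X'.B x.1.2 y.1.2 + Y'.B x.2.2 y.2.2) =
      X.B x.1.1 y.1.1 + -X'.B x.1.2 y.1.2 + (Y.B x.2.1 y.2.1 + -Y'.B x.2.2 y.2.2)
    ring⟩

instance : Neg (WittGroup K) :=
  ⟨Quotient.map SymmSpace.opp fun X Y h => by
    have h' : (X.sum Y.opp).opp.Met := IsMetabolic.neg h
    refine h'.of_equiv (Y := X.opp.sum Y.opp.opp) (LinearEquiv.refl K _) fun x y => ?_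
    change -X.B x.1 y.1 + -(-Y.B x.2 y.2) = -(X.B x.1 y.1 + -Y.B x.2 y.2)
    ring⟩

theorem mk_add (X Y : SymmSpace K) : mk X + mk Y = mk (X.sum Y) := rfl

theorem neg_mk (X : SymmSpace K) : -mk X = mk X.opp := rfl

theorem mk_eq_zero {X : SymmSpace K} : mk X = 0 ↔ X.Met := by
  constructor
  · intro h
    have h' : (X.sum (SymmSpace.zero K).opp).Met := Quotient.exact h
    refine h'.of_equiv (LinearEquiv.prodUnique : (X.V × PUnit) ≃ₗ[K] X.V) fun x y => ?_
    change X.B x.1 y.1 = X.B x.1 y.1 + -0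
    simp
  · intro h
    refine Quotient.sound (SymmSpace.Met.of_equiv (Y := X.sum (SymmSpace.zero K).opp) h
      (LinearEquiv.prodUnique : (X.V × PUnit) ≃ₗ[K] X.V).symm fun x y => ?_)
    change X.B x y + -0 = X.B x y
    simp

instance : AddCommGroup (WittGroup K) where
  add_assoc a b c := by
    induction a, b, c using Quotient.inductionOn₃ with | h X Y Z => ?_
    refine mk_eq_of_isometry (LinearEquiv.prodAssoc K X.V Y.V Z.V) fun x y => ?_
    change X.B x.1.1 y.1.1 + (Y.B x.1.2 y.1.2 + Z.B x.2 y.2) =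
      X.B x.1.1 y.1.1 + Y.B x.1.2 y.1.2 + Z.B x.2 y.2
    ring
  zero_add a := by
    induction a using Quotient.inductionOn with | h X => ?_
    refine mk_eq_of_isometry (LinearEquiv.uniqueProd : (PUnit × X.V) ≃ₗ[K] X.V) fun x y => ?_
    change X.B x.2 y.2 = 0 + X.B x.2 y.2
    simp
  add_zero a := by
    induction a using Quotient.inductionOn with | h X => ?_
    refine mk_eq_of_isometry (LinearEquiv.prodUnique : (X.V × PUnit) ≃ₗ[K] X.V) fun x y => ?_
    change X.B x.1 y.1 = X.B x.1 y.1 + 0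
    simp
  add_comm a b := by
    induction a, b using Quotient.inductionOn₂ with | h X Y => ?_
    refine mk_eq_of_isometry (LinearEquiv.prodComm K X.V Y.V) fun x y => ?_
    change Y.B x.2 y.2 + X.B x.1 y.1 = X.B x.1 y.1 + Y.B x.2 y.2
    ring
  neg_add_cancel a := by
    induction a using Quotient.inductionOn with | h X => ?_
    refine mk_eq_zero.2 (SymmSpace.Met.of_equiv (X := X.sum X.opp) (Y := X.opp.sum X) ?_
      (LinearEquiv.prodComm K X.V X.V) fun x y => ?_)
    · exact SymmSpace.met_sum_opp_of_equiv (LinearEquiv.refl K X.V) fun _ _ => rfl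
    · change -X.B x.2 y.2 + X.B x.1 y.1 = X.B x.1 y.1 + -X.B x.2 y.2
      ring
  nsmul := nsmulRec
  zsmul := zsmulRec

end WittGroup

namespace WittGroup

variable {K : Type} [Field K] {ι κ : Type} [Fintype ι] [DecidableEq ι] [Fintype κ] [DecidableEq κ]

open Module

theorem toBilin'_isSymm {G : Matrix ι ι K} (hG : G.IsSymm) : (Matrix.toBilin' G).IsSymm :=
  ⟨fun x y => by
    rw [Matrix.toBilin'_apply', Matrix.toBilin'_apply', Matrix.dotProduct_mulVec,
      ← Matrix.mulVec_transpose, hG.eq, dotProduct_comm]⟩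

/-- The space with a given nonsingular symmetric Gram matrix. -/
noncomputable def gramSpace (G : Matrix ι ι K) (h : G.IsSymm ∧ G.det ≠ 0) : SymmSpace K where
  V := ι → K
  B := Matrix.toBilin' G
  isSymm := toBilin'_isSymm h.1
  nondegenerate := LinearMap.BilinForm.nondegenerate_toBilin'_iff_det_ne_zero.2 h.2

open Classical in
/-- The Witt class of a Gram matrix, zero if the matrix is singular or not symmetric. -/
noncomputable def ofGram (G : Matrix ι ι K) : WittGroup K :=
  if h : G.IsSymm ∧ G.det ≠ 0 then mk (gramSpace G h) else 0

theorem ofGram_eq {G : Matrix ι ι K} (h : G.IsSymm ∧ G.det ≠ 0) : ofGram G = mk (gramSpace G h) :=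
  dif_pos h

theorem ofGram_eq_zero {G : Matrix ι ι K} (h : G.IsSymm ∧ G.det ≠ 0) :
    ofGram G = 0 ↔ IsMetabolic (Matrix.toBilin' G) := by
  rw [ofGram_eq h, mk_eq_zero]
  rfl

theorem ofGram_congr {G : Matrix ι ι K} {P : Matrix ι ι K} (h : G.IsSymm ∧ G.det ≠ 0)
    (hP : P.det ≠ 0) : ofGram (Pᵀ * G * P) = ofGram G := by
  have h' : (Pᵀ * G * P).IsSymm ∧ (Pᵀ * G * P).det ≠ 0 := by
    refine ⟨?_, by simp [hP, h.2]⟩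
    simp [Matrix.IsSymm, Matrix.transpose_mul, h.1.eq, Matrix.mul_assoc]
  rw [ofGram_eq h, ofGram_eq h']
  refine mk_eq_of_isometry (Matrix.toLinearEquiv' P (P.invertibleOfIsUnitDet hP.isUnit))
    fun (x y : ι → K) => ?_
  change Matrix.toBilin' G (P *ᵥ x) (P *ᵥ y) = Matrix.toBilin' (Pᵀ * G * P) x y
  simp only [Matrix.toBilin'_apply', Matrix.dotProduct_mulVec, ← Matrix.vecMul_vecMul,
    Matrix.vecMul_transpose]

theorem ofGram_submatrix (G : Matrix ι ι K) (e : κ ≃ ι) : ofGram (G.submatrix e e) = ofGram G := by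
  by_cases h : G.IsSymm ∧ G.det ≠ 0
  · have h' : (G.submatrix e e).IsSymm ∧ (G.submatrix e e).det ≠ 0 :=
      ⟨h.1.submatrix e, by rw [Matrix.det_submatrix_equiv_self]; exact h.2⟩
    rw [ofGram_eq h, ofGram_eq h']
    refine mk_eq_of_isometry (LinearEquiv.funCongrLeft K K e.symm) fun (x y : κ → K) => ?_
    change Matrix.toBilin' G (x ∘ e.symm) (y ∘ e.symm) = Matrix.toBilin' (G.submatrix e e) x y
    simp only [Matrix.toBilin'_apply', Matrix.submatrix_mulVec_equiv, dotProduct, Function.comp]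
    rw [← e.sum_comp]
    simp
  · have h' : ¬ ((G.submatrix e e).IsSymm ∧ (G.submatrix e e).det ≠ 0) := by
      rw [Matrix.det_submatrix_equiv_self]
      refine fun h' => h ⟨?_, h'.2⟩
      simpa using h'.1.submatrix e.symm
    rw [ofGram, ofGram, dif_neg h, dif_neg h']

theorem ofGram_fromBlocks {G : Matrix ι ι K} {H : Matrix κ κ K} (hG : G.IsSymm ∧ G.det ≠ 0)
    (hH : H.IsSymm ∧ H.det ≠ 0) :
    ofGram (Matrix.fromBlocks G 0 0 H) = ofGram G + ofGram H := by
  have h : (Matrix.fromBlocks G 0 0 H).IsSymm ∧ (Matrix.fromBlocks G 0 0 H).det ≠ 0 :=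
    ⟨hG.1.fromBlocks (by simp) hH.1, by simp [hG.2, hH.2]⟩
  rw [ofGram_eq h, ofGram_eq hG, ofGram_eq hH, mk_add]
  refine mk_eq_of_isometry (LinearEquiv.sumArrowLequivProdArrow ι κ K K) fun (x y : ι ⊕ κ → K) => ?_
  change Matrix.toBilin' G (x ∘ Sum.inl) (y ∘ Sum.inl) +
    Matrix.toBilin' H (x ∘ Sum.inr) (y ∘ Sum.inr) = Matrix.toBilin' (Matrix.fromBlocks G 0 0 H) x y
  simp [Matrix.toBilin'_apply', Matrix.fromBlocks_mulVec, dotProduct]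

theorem ofGram_neg (G : Matrix ι ι K) : ofGram (-G) = -ofGram G := by
  by_cases h : G.IsSymm ∧ G.det ≠ 0
  · have h' : (-G).IsSymm ∧ (-G).det ≠ 0 := ⟨h.1.neg, by simp [Matrix.det_neg, h.2]⟩
    rw [ofGram_eq h, ofGram_eq h', neg_mk]
    refine mk_eq_of_isometry (LinearEquiv.refl K _) fun (x y : ι → K) => ?_
    change -Matrix.toBilin' G x y = Matrix.toBilin' (-G) x y
    simp
  · have h' : ¬ ((-G).IsSymm ∧ (-G).det ≠ 0) := by
      refine fun h' => h ⟨by simpa using h'.1.neg, fun h0 => h'.2 (by simp [Matrix.det_neg, h0])⟩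
    rw [ofGram, ofGram, dif_neg h, dif_neg h', neg_zero]

/-- The Witt class of the one-dimensional form with value `a`. -/
noncomputable def rankOne (a : K) : WittGroup K := ofGram (Matrix.diagonal fun _ : Fin 1 => a)

theorem diagonal_isSymm_det {w : ι → K} (hw : ∀ i, w i ≠ 0) :
    (Matrix.diagonal w).IsSymm ∧ (Matrix.diagonal w).det ≠ 0 :=
  ⟨Matrix.isSymm_diagonal w, by simp [Finset.prod_ne_zero_iff, hw]⟩

theorem ofGram_diagonal {n : ℕ} {w : Fin n → K} (hw : ∀ i, w i ≠ 0) :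
    ofGram (Matrix.diagonal w) = ∑ i, rankOne (w i) := by
  induction n with
  | zero =>
    rw [Fin.sum_univ_zero, ofGram_eq_zero (diagonal_isSymm_det hw)]
    exact ⟨⊤, fun x _ y _ => by simp [Matrix.toBilin'_apply'], by simp⟩
  | succ n ih =>
    rw [Fin.sum_univ_castSucc, ← ih fun i => hw _, rankOne,
      ← ofGram_fromBlocks (diagonal_isSymm_det fun i => hw _) (diagonal_isSymm_det fun i => hw _),
      Matrix.fromBlocks_diagonal, ← ofGram_submatrix _ (finSumFinEquiv (m := n) (n := 1)),
      Matrix.submatrix_diagonal_equiv]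
    congr 2
    ext i
    rcases i with i | i
    · rfl
    · simp [Subsingleton.elim i 0]
      rfl

theorem rankOne_neg (a : K) : rankOne (-a) = -rankOne a := by
  rw [rankOne, rankOne, ← ofGram_neg, Matrix.diagonal_neg]

theorem rankOne_mul_sq {a s : K} (hs : s ≠ 0) : rankOne (a * s ^ 2) = rankOne a := by
  rcases eq_or_ne a 0 with rfl | ha
  · simp
  rw [rankOne, rankOne, ← ofGram_congr (P := Matrix.diagonal fun _ : Fin 1 => s)
    (diagonal_isSymm_det fun _ => ha) (by simpa using hs)]
  simp only [Matrix.diagonal_transpose, Matrix.diagonal_mul_diagonal]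
  congr 2
  ext
  ring

theorem rankOne_add {a b : K} (ha : a ≠ 0) (hb : b ≠ 0) (hab : a + b ≠ 0) :
    rankOne a + rankOne b = rankOne (a + b) + rankOne (a * b * (a + b)) := by
  have h1 : ∀ i, ![a, b] i ≠ 0 := by simp [Fin.forall_fin_two, ha, hb]
  have h2 : ∀ i, ![a + b, a * b * (a + b)] i ≠ 0 := by simp [Fin.forall_fin_two, ha, hb, hab]
  have e1 := ofGram_diagonal h1
  have e2 := ofGram_diagonal h2
  simp only [Fin.sum_univ_two, Matrix.cons_val_zero, Matrix.cons_val_one] at e1 e2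
  rw [← e1, ← e2, ← ofGram_congr (P := !![1, -b; 1, a]) (diagonal_isSymm_det h1)]
  · congr 1
    ext i j
    fin_cases i <;> fin_cases j <;> simp [Matrix.mul_apply, Fin.sum_univ_two, Matrix.diagonal] <;>
      ring
  · simpa [Matrix.det_fin_two] using hab

end WittGroup

section Integral

open Module

variable {ι : Type} [Fintype ι] [DecidableEq ι]

theorem WittGroup.exists_ofGram_eq_sum {G : Matrix ι ι ℚ} (h : G.IsSymm ∧ G.det ≠ 0) :
    ∃ (n : ℕ) (a : Fin n → ℤ), (∀ i, a i ≠ 0) ∧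
      ofGram G = ∑ i, rankOne (a i : ℚ) := by
  have hs := toBilin'_isSymm h.1
  obtain ⟨v, hv⟩ := LinearMap.BilinForm.exists_orthogonal_basis (B := Matrix.toBilin' G) ⟨hs.eq⟩
  set w : Fin (finrank ℚ (ι → ℚ)) → ℚ := fun i => Matrix.toBilin' G (v i) (v i) with hw
  have key : ∀ x y : Fin (finrank ℚ (ι → ℚ)) → ℚ,
      Matrix.toBilin' G (v.equivFun.symm x) (v.equivFun.symm y) =
        Matrix.toBilin' (Matrix.diagonal w) x y := by
    intro x y
    simp only [Basis.equivFun_symm_apply, map_sum, LinearMap.sum_apply, map_smul,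
      LinearMap.smul_apply, smul_eq_mul, Matrix.toBilin'_apply', dotProduct,
      Matrix.mulVec_diagonal]
    refine Finset.sum_congr rfl fun i _ => ?_
    rw [Finset.sum_eq_single i]
    · rw [hw]
      simp only [Matrix.toBilin'_apply', dotProduct]
      ring
    · intro j _ hj
      have : Matrix.toBilin' G (v j) (v i) = 0 := hv hj
      simp only [Matrix.toBilin'_apply', dotProduct] at this
      rw [this, mul_zero]
    · simp
  have hw0 : ∀ i, w i ≠ 0 := by
    intro i hi
    have hz : v i = 0 := by
      refine (LinearMap.BilinForm.nondegenerate_toBilin'_iff_det_ne_zero.2 h.2).1 _ fun y => ?_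
      obtain ⟨y, rfl⟩ := v.equivFun.symm.surjective y
      have h1 : v i = v.equivFun.symm (Pi.single i 1) := by simp
      rw [h1, key, Matrix.toBilin'_apply']
      simp [Matrix.mulVec_diagonal, hi]
    exact v.ne_zero i hz
  refine ⟨_, fun i => (w i).num * (w i).den, fun i => ?_, ?_⟩
  · simp [hw0 i]
  · have h1 : ofGram G = ofGram (Matrix.diagonal w) := by
      rw [ofGram_eq h, ofGram_eq (diagonal_isSymm_det hw0)]
      exact (mk_eq_of_isometry (X := gramSpace _ (diagonal_isSymm_det hw0)) (Y := gramSpace G h)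
        v.equivFun.symm key).symm
    rw [h1, ofGram_diagonal hw0]
    refine Finset.sum_congr rfl fun i _ => ?_
    have hd : ((w i).den : ℚ) ≠ 0 := by simp
    rw [← rankOne_mul_sq hd]
    congr 1
    push_cast
    rw [pow_two, ← mul_assoc, Rat.mul_den_eq_num]

theorem exists_basis_of_isMetabolic {G : Matrix ι ι ℤ}
    (h : IsMetabolic (Matrix.toBilin' (G.map (Int.cast : ℤ → ℚ)))) :
    ∃ (b : Basis ι ℤ (ι → ℤ)) (r : ℕ) (f : Fin r ↪ ι), Fintype.card ι ≤ 2 * r ∧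
      ∀ i j, b (f i) ⬝ᵥ G *ᵥ b (f j) = 0 := by
  obtain ⟨U, hU, hd⟩ := h
  set c : (ι → ℤ) →ₗ[ℤ] (ι → ℚ) := (Int.castAddHom ℚ).toIntLinearMap.compLeft ι with hc
  have hB : ∀ x y, Matrix.toBilin' (G.map (Int.cast : ℤ → ℚ)) (c x) (c y) =
      ((x ⬝ᵥ G *ᵥ y : ℤ) : ℚ) := by
    intro x y
    simp [hc, Matrix.toBilin'_apply', dotProduct, Matrix.mulVec]
  set N : Submodule ℤ (ι → ℤ) := (U.restrictScalars ℤ).comap c with hN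
  obtain ⟨r, S⟩ := N.smithNormalForm (Pi.basisFun ℤ ι)
  have hmem : ∀ i, c (S.bM (S.f i)) ∈ U := by
    intro i
    have ha : S.a i ≠ 0 := fun ha => by
      have := S.snf i
      rw [ha, zero_smul] at this
      exact S.bN.ne_zero i (Subtype.ext this)
    have h1 : c (S.bN i : ι → ℤ) ∈ U := (S.bN i).2
    rw [S.snf i, map_smul, ← Int.cast_smul_eq_zsmul ℚ] at h1
    exact (U.smul_mem_iff (by exact_mod_cast ha)).1 h1
  refine ⟨S.bM, r, S.f, ?_, fun i j => ?_⟩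
  · rw [finrank_fintype_fun_eq_card] at hd
    refine hd.trans (Nat.mul_le_mul_left 2 ?_)
    have hle : U ≤ Submodule.span ℚ (Set.range fun i => c (S.bN i : ι → ℤ)) := by
      intro u hu
      obtain ⟨d, hd⟩ := IsLocalization.exist_integer_multiples_of_finite (nonZeroDivisors ℤ) u
      choose x hx using hd
      have hd0 : ((d : ℤ) : ℚ) ≠ 0 := by
        exact_mod_cast nonZeroDivisors.ne_zero d.2
      have hx' : c x = ((d : ℤ) : ℚ) • u := by
        ext i
        have := hx i
        simp only [algebraMap_int_eq, eq_intCast, zsmul_eq_mul] at this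
        simpa [hc] using this
      have hxN : x ∈ N := by
        change c x ∈ U
        rw [hx']
        exact U.smul_mem _ hu
      rw [← Submodule.smul_mem_iff _ hd0, ← hx']
      have := S.bN.sum_repr ⟨x, hxN⟩
      rw [← show N.subtype _ = x from congrArg N.subtype this]
      simp only [map_sum, map_smul]
      refine Submodule.sum_mem _ fun i _ => ?_
      rw [← Int.cast_smul_eq_zsmul ℚ]
      exact Submodule.smul_mem _ _ (Submodule.subset_span ⟨i, rfl⟩)
    refine (Submodule.finrank_mono hle).trans ?_
    exact (finrank_range_le_card (R := ℚ) fun i => c (S.bN i : ι → ℤ)).trans (by simp)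
  · have := hU _ (hmem i) _ (hmem j)
    rw [hB] at this
    exact_mod_cast this

theorem linearIndependent_intCast (F : Type) [Field F] (b : Basis ι ℤ (ι → ℤ)) :
    LinearIndependent F fun i j => ((b i j : ℤ) : F) := by
  have h : IsUnit (((Pi.basisFun ℤ ι).toMatrix b).map (Int.castRingHom F)) := by
    refine IsUnit.map (Int.castRingHom F).mapMatrix ?_
    exact IsUnit.of_mul_eq_one _ ((Pi.basisFun ℤ ι).toMatrix_mul_toMatrix_flip b)
  exact Matrix.linearIndependent_cols_iff_isUnit.2 h

theorem IsMetabolic.intCast {G : Matrix ι ι ℤ}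
    (h : IsMetabolic (Matrix.toBilin' (G.map (Int.cast : ℤ → ℚ)))) (F : Type) [Field F] :
    IsMetabolic (Matrix.toBilin' (G.map (Int.cast : ℤ → F))) := by
  obtain ⟨b, r, f, hr, hf⟩ := exists_basis_of_isMetabolic h
  have hli := (linearIndependent_intCast F b).comp f f.injective
  refine ⟨Submodule.span F (Set.range ((fun i j => ((b i j : ℤ) : F)) ∘ f)), ?_, ?_⟩
  · intro x hx y hy
    induction hx, hy using Submodule.span_induction₂ with
    | mem_mem x y hx hy =>
      obtain ⟨i, rfl⟩ := hx
      obtain ⟨j, rfl⟩ := hy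
      have := congrArg (Int.cast : ℤ → F) (hf i j)
      simpa [Matrix.toBilin'_apply', dotProduct, Matrix.mulVec] using this
    | zero_left y hy => simp
    | zero_right x hx => simp
    | add_left x y z _ _ _ h1 h2 => rw [map_add, LinearMap.add_apply, h1, h2, add_zero]
    | add_right x y z _ _ _ h1 h2 => rw [map_add, h1, h2, add_zero]
    | smul_left r x y _ _ h => rw [map_smul, LinearMap.smul_apply, h, smul_zero]
    | smul_right r x y _ _ h => rw [map_smul, h, smul_zero]
  · rw [finrank_span_eq_card hli]
    simpa using hr

/-- A form that is unimodular at `p`, plus `p` times a form anisotropic modulo `p`, is not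
metabolic. -/
theorem not_isMetabolic_fromBlocks {κ : Type} [Fintype κ] [DecidableEq κ] [Nonempty κ] (p : ℕ)
    [Fact p.Prime] {G : Matrix ι ι ℤ} (hG : ¬ (p : ℤ) ∣ G.det) {w : κ → ℤ}
    (hw : ∀ x : κ → ℤ, (p : ℤ) ∣ ∑ k, w k * x k ^ 2 → ∀ k, (p : ℤ) ∣ x k) :
    ¬ IsMetabolic (Matrix.toBilin'
      ((Matrix.fromBlocks G 0 0 (Matrix.diagonal fun k => p * w k)).map (Int.cast : ℤ → ℚ))) := by
  intro h
  obtain ⟨b, r, f, hr, hf⟩ := exists_basis_of_isMetabolic h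
  have hli := (linearIndependent_intCast (ZMod p) b).comp f f.injective
  have hform : ∀ x y : ι ⊕ κ → ℤ,
      x ⬝ᵥ Matrix.fromBlocks G 0 0 (Matrix.diagonal fun k => (p : ℤ) * w k) *ᵥ y =
        (x ∘ Sum.inl) ⬝ᵥ G *ᵥ (y ∘ Sum.inl) + p * ∑ k, w k * (x (Sum.inr k) * y (Sum.inr k)) := by
    intro x y
    simp only [Matrix.fromBlocks_mulVec, dotProduct, Fintype.sum_sum_type, Sum.elim_inl,
      Sum.elim_inr, Matrix.zero_mulVec, add_zero, zero_add, Matrix.mulVec_diagonal, Finset.mul_sum,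
      Function.comp]
    congr 1
    exact Finset.sum_congr rfl fun k _ => by ring
  set B := Matrix.toBilin' (G.map (Int.cast : ℤ → ZMod p))
  have hB : B.Nondegenerate := by
    refine LinearMap.BilinForm.nondegenerate_toBilin'_iff_det_ne_zero.2 ?_
    rw [← Int.cast_det, Ne, ZMod.intCast_zmod_eq_zero_iff_dvd]
    exact hG
  set φ : (Fin r → ZMod p) →ₗ[ZMod p] (ι → ZMod p) :=
    Fintype.linearCombination (ZMod p) fun i (j : ι) => ((b (f i) (Sum.inl j) : ℤ) : ZMod p)
  have hφ : ∀ c d : Fin r → ZMod p, B (φ c) (φ d) = 0 := by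
    intro c d
    simp only [φ, Fintype.linearCombination_apply, map_sum, LinearMap.sum_apply, map_smul,
      LinearMap.smul_apply]
    refine Finset.sum_eq_zero fun i _ => ?_
    refine smul_eq_zero_of_right _ (Finset.sum_eq_zero fun j _ => ?_)
    have := congrArg (Int.cast : ℤ → ZMod p) (hf j i)
    rw [hform] at this
    simp [dotProduct, Matrix.mulVec] at this
    simp [B, Matrix.toBilin'_apply', dotProduct, Matrix.mulVec, this]
  have hrange := two_mul_finrank_le hB (U := φ.range) (by
    rintro _ ⟨c, rfl⟩ _ ⟨d, rfl⟩
    exact hφ c d)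
  have hrk := φ.finrank_range_add_finrank_ker
  rw [finrank_fintype_fun_eq_card] at hrange hrk
  rw [Fintype.card_sum] at hr
  have hκ : 0 < Fintype.card κ := Fintype.card_pos
  rw [Fintype.card_fin] at hrk
  have hker : φ.ker ≠ ⊥ := by
    intro h0
    rw [h0, finrank_bot] at hrk
    omega
  obtain ⟨c, hc, hc0⟩ := Submodule.exists_mem_ne_zero_of_ne_bot hker
  set x : ι ⊕ κ → ℤ := ∑ i, ((c i).val : ℤ) • b (f i) with hx
  have hxcast : (fun j => ((x j : ℤ) : ZMod p)) =
      ∑ i, c i • ((fun i j => ((b i j : ℤ) : ZMod p)) ∘ f) i := by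
    ext j
    simp only [hx, Finset.sum_apply, Pi.smul_apply, smul_eq_mul, Int.cast_sum, Int.cast_mul,
      Int.cast_natCast, ZMod.natCast_zmod_val, Function.comp]
  have hxl : ∀ j : ι, (p : ℤ) ∣ x (Sum.inl j) := by
    intro j
    rw [← ZMod.intCast_zmod_eq_zero_iff_dvd]
    have h1 := congrFun hxcast (Sum.inl j)
    have h2 := congrFun (LinearMap.mem_ker.1 hc) j
    simp only [φ, Fintype.linearCombination_apply, Finset.sum_apply, Pi.smul_apply] at h2
    simp only [Finset.sum_apply, Pi.smul_apply, Function.comp] at h1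
    rw [h1, h2]
    rfl
  have hxx : x ⬝ᵥ Matrix.fromBlocks G 0 0 (Matrix.diagonal fun k => (p : ℤ) * w k) *ᵥ x = 0 := by
    simp only [hx, Matrix.mulVec_sum, Matrix.mulVec_smul, sum_dotProduct, dotProduct_sum,
      smul_dotProduct, dotProduct_smul, hf, smul_zero, Finset.sum_const_zero]
  rw [hform] at hxx
  choose z hz using hxl
  have hp0 : (p : ℤ) ≠ 0 := by exact_mod_cast (Fact.out : p.Prime).ne_zero
  have hxz : x ∘ Sum.inl = (p : ℤ) • z := funext fun j => hz j
  rw [hxz, Matrix.mulVec_smul, smul_dotProduct, dotProduct_smul, smul_eq_mul, smul_eq_mul,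
    ← mul_add] at hxx
  have hsum := (mul_eq_zero.1 hxx).resolve_left hp0
  have hxr : ∀ k, (p : ℤ) ∣ x (Sum.inr k) := by
    refine hw (fun k => x (Sum.inr k)) ⟨-(z ⬝ᵥ G *ᵥ z), ?_⟩
    simp only [pow_two]
    linarith
  refine hc0 (funext (Fintype.linearIndependent_iff.1 hli c ?_))
  rw [← hxcast]
  ext j
  refine (ZMod.intCast_zmod_eq_zero_iff_dvd _ _).2 ?_
  rcases j with j | k
  · exact ⟨z j, hz j⟩
  · exact hxr k

end Integral

section Filtration

open WittGroup

/-- The Witt class over `ℚ` of the one-dimensional form with integer value `u`. -/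
noncomputable def intClass (u : ℤ) : WittGroup ℚ := rankOne (u : ℚ)

theorem intClass_neg (u : ℤ) : intClass (-u) = -intClass u := by
  rw [intClass, Int.cast_neg, rankOne_neg, intClass]

theorem intClass_mul_sq (u : ℤ) {s : ℤ} (hs : s ≠ 0) : intClass (u * s ^ 2) = intClass u := by
  rw [intClass, Int.cast_mul, Int.cast_pow, rankOne_mul_sq (by exact_mod_cast hs), intClass]

theorem intClass_add {a b : ℤ} (ha : a ≠ 0) (hb : b ≠ 0) (hab : a + b ≠ 0) :
    intClass a + intClass b = intClass (a + b) + intClass (a * b * (a + b)) := by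
  simp only [intClass, Int.cast_mul, Int.cast_add]
  exact rankOne_add (by exact_mod_cast ha) (by exact_mod_cast hb) (by exact_mod_cast hab)

/-- Nonzero integers all of whose prime factors are smaller than `p`. -/
def IsSmooth (p : ℕ) (u : ℤ) : Prop := u ≠ 0 ∧ ∀ q : ℕ, q.Prime → (q : ℤ) ∣ u → q < p

theorem IsSmooth.mul {p : ℕ} {u v : ℤ} (hu : IsSmooth p u) (hv : IsSmooth p v) :
    IsSmooth p (u * v) := by
  refine ⟨mul_ne_zero hu.1 hv.1, fun q hq hd => ?_⟩
  rcases (Nat.prime_iff_prime_int.1 hq).dvd_or_dvd hd with h | h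
  · exact hu.2 q hq h
  · exact hv.2 q hq h

theorem IsSmooth.of_abs_lt {p : ℕ} {u : ℤ} (h0 : u ≠ 0) (h : |u| < p) : IsSmooth p u := by
  refine ⟨h0, fun q _ hd => ?_⟩
  have := Int.le_of_dvd (abs_pos.2 h0) ((dvd_abs _ _).2 hd)
  omega

theorem IsSmooth.neg {p : ℕ} {u : ℤ} (hu : IsSmooth p u) : IsSmooth p (-u) :=
  ⟨neg_ne_zero.2 hu.1, fun q hq hd => hu.2 q hq ((dvd_neg).1 hd)⟩

theorem IsSmooth.not_dvd {p : ℕ} (hp : p.Prime) {u : ℤ} (hu : IsSmooth p u) : ¬ (p : ℤ) ∣ u :=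
  fun h => lt_irrefl p (hu.2 p hp h)

theorem IsSmooth.of_mul {p : ℕ} {u v : ℤ} (h : IsSmooth p (u * v)) : IsSmooth p v :=
  ⟨right_ne_zero_of_mul h.1, fun q hq hd => h.2 q hq (hd.mul_left u)⟩

/-- The subgroup of the Witt group of `ℚ` generated by forms with `p`-smooth values. -/
noncomputable def smoothSubgroup (p : ℕ) : AddSubgroup (WittGroup ℚ) :=
  AddSubgroup.closure {x | ∃ u, IsSmooth p u ∧ intClass u = x}

theorem intClass_mem {p : ℕ} {u : ℤ} (hu : IsSmooth p u) : intClass u ∈ smoothSubgroup p :=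
  AddSubgroup.subset_closure ⟨u, hu, rfl⟩

theorem mul_sq_zmod_two : ∀ z c : ZMod 2, z ≠ 0 → z * c ^ 2 = c := by decide

section Prime

variable {p : ℕ} [hp : Fact p.Prime]

theorem intClass_mul_mul_sub_mem {a b c : ℤ} (ha0 : a ≠ 0) (ha : |a| < p) (hb0 : b ≠ 0)
    (hb : |b| < p) (hc : IsSmooth p c) :
    intClass (p * c * (a * b)) - intClass (p * c * (a * b % p)) ∈ smoothSubgroup p := by
  have hp0 : (0 : ℤ) < p := by exact_mod_cast hp.out.pos
  have hsa := IsSmooth.of_abs_lt ha0 ha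
  have hsb := IsSmooth.of_abs_lt hb0 hb
  set r := a * b % p with hr
  set l := a * b / p with hl
  have hrl : r + p * l = a * b := Int.emod_add_mul_ediv (a * b) p
  have hr0 : r ≠ 0 := fun h => (hsa.mul hsb).not_dvd hp.out (Int.dvd_of_emod_eq_zero h)
  have hr1 : 0 ≤ r := Int.emod_nonneg _ hp0.ne'
  have hr2 : r < p := Int.emod_lt_of_pos _ hp0
  have hsr : IsSmooth p r := IsSmooth.of_abs_lt hr0 (by rwa [abs_of_nonneg hr1])
  rcases eq_or_ne l 0 with h0 | h0
  · rw [h0, mul_zero, add_zero] at hrl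
    rw [hrl, sub_self]
    exact zero_mem _
  have hlp : |l| < p := by
    have h1 : p * |l| = |a * b - r| := by
      rw [← hrl, add_sub_cancel_left, abs_mul, abs_of_pos hp0]
    have h2 : |a * b - r| ≤ |a| * |b| + r := by
      have := abs_sub (a * b) r
      rwa [abs_mul, abs_of_nonneg hr1] at this
    have h3 : |a| * |b| ≤ (p - 1) * (p - 1) :=
      mul_le_mul (by omega) (by omega) (abs_nonneg b) (by omega)
    nlinarith
  have hsl := IsSmooth.of_abs_lt h0 hlp
  have hsum : p * c * r + p ^ 2 * c * l = p * c * (a * b) := by rw [← hrl]; ring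
  have hpc : (p : ℤ) * c ≠ 0 := mul_ne_zero hp0.ne' hc.1
  have key := intClass_add (a := p * c * r) (b := p ^ 2 * c * l) (mul_ne_zero hpc hr0)
    (mul_ne_zero (mul_ne_zero (pow_ne_zero 2 hp0.ne') hc.1) h0)
    (by rw [hsum]; exact mul_ne_zero hpc (mul_ne_zero ha0 hb0))
  rw [hsum, show (p : ℤ) ^ 2 * c * l = c * l * p ^ 2 by ring, intClass_mul_sq _ hp0.ne',
    show p * c * r * (c * l * p ^ 2) * (p * c * (a * b)) =
      c * r * l * (a * b) * (p ^ 2 * c) ^ 2 by ring,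
    intClass_mul_sq _ (mul_ne_zero (pow_ne_zero 2 hp0.ne') hc.1)] at key
  rw [show intClass (p * c * (a * b)) - intClass (p * c * r) =
    intClass (c * l) - intClass (c * r * l * (a * b)) by
      rw [sub_eq_sub_iff_add_eq_add, add_comm (intClass (c * l)), key]]
  exact sub_mem (intClass_mem (hc.mul hsl))
    (intClass_mem (((hc.mul hsr).mul hsl).mul (hsa.mul hsb)))

theorem intClass_mul_mul_sub_mem_of_smooth {a u : ℤ} (ha0 : a ≠ 0) (ha : |a| < p)
    (hu : IsSmooth p u) (h : ∀ c, IsSmooth p c →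
      intClass (p * c * u) - intClass (p * c * (u % p)) ∈ smoothSubgroup p)
    (c : ℤ) (hc : IsSmooth p c) :
    intClass (p * c * (a * u)) - intClass (p * c * (a * u % p)) ∈ smoothSubgroup p := by
  have hp0 : (0 : ℤ) < p := by exact_mod_cast hp.out.pos
  have h1 := h (c * a) (hc.mul (IsSmooth.of_abs_lt ha0 ha))
  have h2 := intClass_mul_mul_sub_mem (b := u % p) ha0 ha
    (fun h => hu.not_dvd hp.out (Int.dvd_of_emod_eq_zero h))
    (by rw [abs_of_nonneg (Int.emod_nonneg _ hp0.ne')]; exact Int.emod_lt_of_pos _ hp0) hc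
  have h3 := add_mem h1 h2
  rw [show a * (u % p) % p = a * u % p by simp [Int.mul_emod]] at h3
  rw [show (p : ℤ) * (c * a) * u = p * c * (a * u) by ring,
    show (p : ℤ) * (c * a) * (u % p) = p * c * (a * (u % p)) by ring, sub_add_sub_cancel] at h3
  exact h3

theorem intClass_sub_emod_mem {u : ℤ} (hu : IsSmooth p u) :
    intClass (p * u) - intClass (p * (u % p)) ∈ smoothSubgroup p := by
  have h2 := hp.out.two_le
  have hnat : ∀ n : ℕ, IsSmooth p n → ∀ c, IsSmooth p c →
      intClass (p * c * n) - intClass (p * c * (n % p)) ∈ smoothSubgroup p := by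
    intro n
    induction n using induction_on_primes with
    | zero => exact fun h => absurd rfl h.1
    | one =>
      intro _ c _
      rw [Nat.cast_one, Int.emod_eq_of_lt zero_le_one (by exact_mod_cast h2), sub_self]
      exact zero_mem _
    | prime_mul q n hq ih =>
      intro h c hc
      rw [Nat.cast_mul] at h ⊢
      have hqp := h.2 q hq (dvd_mul_right _ _)
      exact intClass_mul_mul_sub_mem_of_smooth (by exact_mod_cast hq.ne_zero)
        (by rw [abs_of_nonneg (Int.natCast_nonneg q)]; exact_mod_cast hqp) h.of_mul
        (ih h.of_mul) c hc
  have h1 : IsSmooth p 1 := IsSmooth.of_abs_lt one_ne_zero (by rw [abs_one]; exact_mod_cast h2)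
  suffices h : ∀ c, IsSmooth p c →
      intClass (p * c * u) - intClass (p * c * (u % p)) ∈ smoothSubgroup p by
    simpa using h 1 h1
  obtain ⟨n, rfl | rfl⟩ := u.eq_nat_or_neg
  · exact hnat n hu
  · have hn : IsSmooth p n := by simpa using hu.neg
    have := intClass_mul_mul_sub_mem_of_smooth (p := p) (a := -1) (by norm_num)
      (by rw [abs_neg, abs_one]; exact_mod_cast h2) hn (hnat n hn)
    simpa using this

variable (p) in
/-- The class of `⟨p z⟩` modulo forms with `p`-smooth values. -/
noncomputable def residueClass (z : ZMod p) : WittGroup ℚ ⧸ smoothSubgroup p :=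
  QuotientAddGroup.mk (intClass (p * z.val))

theorem mk_intClass_mul {u : ℤ} (hu : IsSmooth p u) :
    (QuotientAddGroup.mk (intClass (p * u)) : WittGroup ℚ ⧸ smoothSubgroup p) =
      residueClass p u := by
  rw [residueClass, ZMod.val_intCast, ← sub_eq_zero, ← QuotientAddGroup.mk_sub,
    QuotientAddGroup.eq_zero_iff]
  exact intClass_sub_emod_mem hu

theorem isSmooth_val {z : ZMod p} (hz : z ≠ 0) : IsSmooth p (z.val : ℤ) :=
  IsSmooth.of_abs_lt (by exact_mod_cast (ZMod.val_ne_zero z).2 hz)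
    (by rw [abs_of_nonneg (Int.natCast_nonneg _)]; exact_mod_cast z.val_lt)

theorem residueClass_neg {z : ZMod p} (hz : z ≠ 0) : residueClass p (-z) = -residueClass p z := by
  have h := mk_intClass_mul (isSmooth_val hz).neg
  rw [Int.cast_neg, Int.cast_natCast, ZMod.natCast_zmod_val] at h
  rw [← h, mul_neg, intClass_neg, QuotientAddGroup.mk_neg, residueClass]

theorem residueClass_mul_sq {z s : ZMod p} (hz : z ≠ 0) (hs : s ≠ 0) :
    residueClass p (z * s ^ 2) = residueClass p z := by
  have hs' := isSmooth_val hs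
  have h := mk_intClass_mul ((isSmooth_val hz).mul (hs'.mul hs'))
  rw [← pow_two, ← mul_assoc, intClass_mul_sq _ hs'.1] at h
  simp only [Int.cast_mul, Int.cast_pow, Int.cast_natCast, ZMod.natCast_zmod_val] at h
  rw [← h, residueClass]

theorem residueClass_add {z w : ZMod p} (hz : z ≠ 0) (hw : w ≠ 0) (hzw : z + w ≠ 0) :
    residueClass p z + residueClass p w =
      residueClass p (z + w) + residueClass p (z * w * (z + w)) := by
  have hp0 : (p : ℤ) ≠ 0 := by exact_mod_cast hp.out.ne_zero
  set v : ℤ := (z + w).val - z.val with hv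
  have hvw : (v : ZMod p) = w := by simp [hv]
  have hv0 : v ≠ 0 := fun h => hw (by rw [← hvw, h, Int.cast_zero])
  have hsv : IsSmooth p v := by
    refine IsSmooth.of_abs_lt hv0 (abs_lt.2 ?_)
    have h1 := (z + w).val_lt
    have h2 := z.val_lt
    omega
  have hsz := isSmooth_val hz
  have hst := isSmooth_val hzw
  have hsum : (p : ℤ) * z.val + p * v = p * (z + w).val := by rw [hv]; ring
  have key := intClass_add (mul_ne_zero hp0 hsz.1) (mul_ne_zero hp0 hv0)
    (by rw [hsum]; exact mul_ne_zero hp0 hst.1)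
  rw [hsum, show (p : ℤ) * z.val * (p * v) * (p * (z + w).val) =
    p * (z.val * v * (z + w).val) * p ^ 2 by ring, intClass_mul_sq _ hp0] at key
  have key' := congrArg (QuotientAddGroup.mk (s := smoothSubgroup p)) key
  simp only [QuotientAddGroup.mk_add] at key'
  rw [mk_intClass_mul hsz, mk_intClass_mul hsv, mk_intClass_mul hst,
    mk_intClass_mul ((hsz.mul hsv).mul hst), hvw] at key'
  simpa [hvw] using key'

theorem exists_mul_sq_add_mul_sq {z w : ZMod p} (hz : z ≠ 0) (hw : w ≠ 0) (c : ZMod p) :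
    ∃ s t, z * s ^ 2 + w * t ^ 2 = c := by
  rcases hp.out.eq_two_or_odd with h2 | h2
  · subst h2
    exact ⟨c, 0, by rw [mul_sq_zmod_two z c hz]; ring⟩
  · obtain ⟨s, t, h⟩ := FiniteField.exists_root_sum_quadratic (R := ZMod p)
      (f := Polynomial.C z * Polynomial.X ^ 2)
      (g := Polynomial.C w * Polynomial.X ^ 2 - Polynomial.C c)
      (Polynomial.degree_C_mul_X_pow 2 hz)
      (by
        have h2 : (2 : WithBot ℕ) = (2 : ℕ) := rfl
        rw [Polynomial.degree_sub_C, Polynomial.degree_C_mul_X_pow 2 hw, h2]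
        rw [Polynomial.degree_C_mul_X_pow 2 hw]
        exact Nat.cast_pos.2 two_pos) (by rwa [ZMod.card])
    refine ⟨s, t, ?_⟩
    simp at h
    linear_combination h

theorem residueClass_add_eq {z w c : ZMod p} (hz : z ≠ 0) (hw : w ≠ 0) (hc : c ≠ 0) :
    residueClass p z + residueClass p w = residueClass p c + residueClass p (c * z * w) := by
  obtain ⟨s, t, h⟩ := exists_mul_sq_add_mul_sq hz hw c
  rcases eq_or_ne s 0 with rfl | hs
  · have ht : t ≠ 0 := by
      rintro rfl
      exact hc (by rw [← h]; ring)
    rw [← h, show (z * 0 ^ 2 + w * t ^ 2) = w * t ^ 2 by ring, residueClass_mul_sq hw ht,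
      show w * t ^ 2 * z * w = z * (w * t) ^ 2 by ring,
      residueClass_mul_sq hz (mul_ne_zero hw ht), add_comm]
  rcases eq_or_ne t 0 with rfl | ht
  · rw [← h, show (z * s ^ 2 + w * 0 ^ 2) = z * s ^ 2 by ring, residueClass_mul_sq hz hs,
      show z * s ^ 2 * z * w = w * (z * s) ^ 2 by ring,
      residueClass_mul_sq hw (mul_ne_zero hz hs)]
  · have := residueClass_add (mul_ne_zero hz (pow_ne_zero 2 hs)) (mul_ne_zero hw (pow_ne_zero 2 ht))
      (by rwa [h])
    rw [h, residueClass_mul_sq hz hs, residueClass_mul_sq hw ht,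
      show z * s ^ 2 * (w * t ^ 2) * c = c * z * w * (s * t) ^ 2 by ring,
      residueClass_mul_sq (mul_ne_zero (mul_ne_zero hc hz) hw) (mul_ne_zero hs ht)] at this
    exact this

theorem exists_isSmooth_intClass {u : ℤ} (hu : IsSmooth (p + 1) u) :
    ∃ v, IsSmooth p v ∧ (intClass u = intClass v ∨ intClass u = intClass (p * v)) := by
  have hp0 : (p : ℤ) ≠ 0 := by exact_mod_cast hp.out.ne_zero
  obtain ⟨e, v, hv, rfl⟩ : ∃ (e : ℕ) (v : ℤ), ¬ (p : ℤ) ∣ v ∧ u = p ^ e * v := by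
    have hf : FiniteMultiplicity (p : ℤ) u :=
      Int.finiteMultiplicity_iff.2 ⟨by simpa using hp.out.ne_one, hu.1⟩
    obtain ⟨v, hv, hv'⟩ := hf.exists_eq_pow_mul_and_not_dvd
    exact ⟨_, v, hv', hv⟩
  have hsv : IsSmooth p v := by
    refine ⟨right_ne_zero_of_mul hu.1, fun q hq hd => ?_⟩
    have h1 := hu.2 q hq (hd.mul_left _)
    have h2 : q ≠ p := by
      rintro rfl
      exact hv hd
    omega
  refine ⟨v, hsv, ?_⟩
  obtain ⟨k, rfl | rfl⟩ := e.even_or_odd'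
  · left
    rw [← intClass_mul_sq v (pow_ne_zero k hp0)]
    congr 1
    ring
  · right
    rw [← intClass_mul_sq (p * v) (pow_ne_zero k hp0)]
    congr 1
    ring

/-- Modulo forms with `p`-smooth values, a form whose values have prime factors at most `p` is
`p` times a form of dimension at most two that is anisotropic modulo `p`. -/
theorem mk_eq_residueClass {x : WittGroup ℚ} (hx : x ∈ smoothSubgroup (p + 1)) :
    (x : WittGroup ℚ ⧸ smoothSubgroup p) = 0 ∨
    (∃ z, z ≠ 0 ∧ (x : WittGroup ℚ ⧸ smoothSubgroup p) = residueClass p z) ∨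
    ∃ z w, (∀ s t, z * s ^ 2 + w * t ^ 2 = 0 → s = 0 ∧ t = 0) ∧
      (x : WittGroup ℚ ⧸ smoothSubgroup p) = residueClass p z + residueClass p w := by
  have hpair : ∀ z w : ZMod p, z ≠ 0 → w ≠ 0 →
      residueClass p z + residueClass p w = 0 ∨
        ∀ s t, z * s ^ 2 + w * t ^ 2 = 0 → s = 0 ∧ t = 0 := by
    intro z w hz hw
    by_contra! hcon
    obtain ⟨hne, s, t, hst, h0⟩ := hcon
    have hs : s ≠ 0 := by
      rintro rfl
      exact h0 rfl (by simpa [hw] using hst)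
    have ht : t ≠ 0 := by
      rintro rfl
      exact hs (by simpa [hz] using hst)
    refine hne ?_
    rw [← residueClass_mul_sq hz hs, show z * s ^ 2 = -(w * t ^ 2) by linear_combination hst,
      residueClass_neg (mul_ne_zero hw (pow_ne_zero 2 ht)), residueClass_mul_sq hw ht,
      neg_add_cancel]
  have hne : ∀ z w : ZMod p, (∀ s t, z * s ^ 2 + w * t ^ 2 = 0 → s = 0 ∧ t = 0) →
      z ≠ 0 ∧ w ≠ 0 := by
    refine fun z w h => ⟨?_, ?_⟩
    · rintro rfl
      exact one_ne_zero (h 1 0 (by ring)).1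
    · rintro rfl
      exact one_ne_zero (h 0 1 (by ring)).2
  have hadd : ∀ (v : ZMod p) (y : WittGroup ℚ ⧸ smoothSubgroup p), v ≠ 0 →
      (y = 0 ∨ (∃ z, z ≠ 0 ∧ y = residueClass p z) ∨
        ∃ z w, (∀ s t, z * s ^ 2 + w * t ^ 2 = 0 → s = 0 ∧ t = 0) ∧
          y = residueClass p z + residueClass p w) →
      (residueClass p v + y = 0 ∨ (∃ z, z ≠ 0 ∧ residueClass p v + y = residueClass p z) ∨
        ∃ z w, (∀ s t, z * s ^ 2 + w * t ^ 2 = 0 → s = 0 ∧ t = 0) ∧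
          residueClass p v + y = residueClass p z + residueClass p w) := by
    rintro v y hv (rfl | ⟨z, hz, rfl⟩ | ⟨z, w, hzw, rfl⟩)
    · exact Or.inr (Or.inl ⟨v, hv, add_zero _⟩)
    · rcases hpair v z hv hz with h | h
      · exact Or.inl h
      · exact Or.inr (Or.inr ⟨v, z, h, rfl⟩)
    · obtain ⟨hz, hw⟩ := hne z w hzw
      refine Or.inr (Or.inl ⟨-v * z * w, ?_, ?_⟩)
      · exact mul_ne_zero (mul_ne_zero (neg_ne_zero.2 hv) hz) hw
      · rw [residueClass_add_eq hz hw (neg_ne_zero.2 hv), residueClass_neg hv,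
          add_neg_cancel_left]
  have hgen : ∀ u, IsSmooth (p + 1) u →
      (intClass u : WittGroup ℚ ⧸ smoothSubgroup p) = 0 ∨
      ∃ v, v ≠ 0 ∧ (intClass u : WittGroup ℚ ⧸ smoothSubgroup p) = residueClass p v := by
    intro u hu
    obtain ⟨v, hv, h | h⟩ := exists_isSmooth_intClass hu
    · left
      rw [h, QuotientAddGroup.eq_zero_iff]
      exact intClass_mem hv
    · right
      refine ⟨v, ?_, by rw [h, mk_intClass_mul hv]⟩
      rw [Ne, ZMod.intCast_zmod_eq_zero_iff_dvd]
      exact hv.not_dvd hp.out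
  induction hx using AddSubgroup.closure_induction_left with
  | zero => exact Or.inl rfl
  | add_left x hx y _ ih =>
    obtain ⟨u, hu, rfl⟩ := hx
    rw [QuotientAddGroup.mk_add]
    rcases hgen u hu with h1 | ⟨v, hv, h1⟩
    · rw [h1, zero_add]
      exact ih
    · rw [h1]
      exact hadd v y hv ih
  | neg_add_cancel x hx y _ ih =>
    obtain ⟨u, hu, rfl⟩ := hx
    rw [QuotientAddGroup.mk_add, ← intClass_neg]
    rcases hgen (-u) hu.neg with h1 | ⟨v, hv, h1⟩
    · rw [h1, zero_add]
      exact ih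
    · rw [h1]
      exact hadd v y hv ih

end Prime

end Filtration

section Descent

open WittGroup

variable {ι κ : Type} [Fintype ι] [DecidableEq ι] [Fintype κ] [DecidableEq κ]

theorem map_intCast_isSymm_det {G : Matrix ι ι ℤ} (h : G.IsSymm ∧ G.det ≠ 0) (F : Type) [Field F]
    [CharZero F] : (G.map (Int.cast : ℤ → F)).IsSymm ∧ (G.map (Int.cast : ℤ → F)).det ≠ 0 := by
  refine ⟨h.1.map _, ?_⟩
  have := Int.cast_det (R := F) G
  rw [← this]
  exact_mod_cast h.2

theorem ofGram_map_fromBlocks {G : Matrix ι ι ℤ} {H : Matrix κ κ ℤ} (hG : G.IsSymm ∧ G.det ≠ 0)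
    (hH : H.IsSymm ∧ H.det ≠ 0) (F : Type) [Field F] [CharZero F] :
    ofGram ((Matrix.fromBlocks G 0 0 H).map (Int.cast : ℤ → F)) =
      ofGram (G.map (Int.cast : ℤ → F)) + ofGram (H.map (Int.cast : ℤ → F)) := by
  rw [Matrix.fromBlocks_map, Matrix.map_zero _ Int.cast_zero, Matrix.map_zero _ Int.cast_zero,
    ofGram_fromBlocks (map_intCast_isSymm_det hG F) (map_intCast_isSymm_det hH F)]

theorem int_diagonal_isSymm_det {w : ι → ℤ} (hw : ∀ i, w i ≠ 0) :
    (Matrix.diagonal w).IsSymm ∧ (Matrix.diagonal w).det ≠ 0 :=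
  ⟨Matrix.isSymm_diagonal w, by
    rw [Matrix.det_diagonal]
    exact Finset.prod_ne_zero_iff.2 fun i _ => hw i⟩

theorem ofGram_map_diagonal {n : ℕ} {w : Fin n → ℤ} (hw : ∀ i, w i ≠ 0) (F : Type) [Field F]
    [CharZero F] :
    ofGram ((Matrix.diagonal w).map (Int.cast : ℤ → F)) = ∑ i, rankOne (w i : F) := by
  rw [Matrix.diagonal_map Int.cast_zero]
  exact ofGram_diagonal (w := fun i => ((w i : ℤ) : F)) fun i => by exact_mod_cast hw i

/-- The vanishing of a rational Witt class of an integral form may be tested over any field of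
characteristic zero. -/
theorem ofGram_map_eq_zero {G : Matrix ι ι ℤ} (h : G.IsSymm ∧ G.det ≠ 0)
    (h0 : ofGram (G.map (Int.cast : ℤ → ℚ)) = 0) (F : Type) [Field F] [CharZero F] :
    ofGram (G.map (Int.cast : ℤ → F)) = 0 :=
  (ofGram_eq_zero (map_intCast_isSymm_det h F)).2
    (((ofGram_eq_zero (map_intCast_isSymm_det h ℚ)).1 h0).intCast F)

theorem exists_ofGram_of_mem {p : ℕ} (hp : p.Prime) {x : WittGroup ℚ} (hx : x ∈ smoothSubgroup p) :
    ∃ (κ : Type) (_ : Fintype κ) (_ : DecidableEq κ) (H : Matrix κ κ ℤ), H.IsSymm ∧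
      ¬ (p : ℤ) ∣ H.det ∧ ofGram (H.map (Int.cast : ℤ → ℚ)) = x := by
  have hstep : ∀ u y, IsSmooth p u →
      (∃ (κ : Type) (_ : Fintype κ) (_ : DecidableEq κ) (H : Matrix κ κ ℤ), H.IsSymm ∧
        ¬ (p : ℤ) ∣ H.det ∧ ofGram (H.map (Int.cast : ℤ → ℚ)) = y) →
      ∃ (κ : Type) (_ : Fintype κ) (_ : DecidableEq κ) (H : Matrix κ κ ℤ), H.IsSymm ∧
        ¬ (p : ℤ) ∣ H.det ∧ ofGram (H.map (Int.cast : ℤ → ℚ)) = intClass u + y := by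
    rintro u _ hu ⟨κ, _, _, H, hs, hd, rfl⟩
    have hw := int_diagonal_isSymm_det (w := fun _ : Fin 1 => u) fun _ => hu.1
    refine ⟨Fin 1 ⊕ κ, inferInstance, inferInstance,
      Matrix.fromBlocks (Matrix.diagonal fun _ : Fin 1 => u) 0 0 H,
      hw.1.fromBlocks (by simp) hs, ?_, ?_⟩
    · rw [Matrix.det_fromBlocks_zero₂₁, Matrix.det_diagonal, Fin.prod_univ_one,
        (Nat.prime_iff_prime_int.1 hp).dvd_mul]
      exact not_or.2 ⟨hu.not_dvd hp, hd⟩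
    · rw [ofGram_map_fromBlocks hw ⟨hs, fun h => hd (h ▸ dvd_zero _)⟩,
        ofGram_map_diagonal fun _ => hu.1, Fin.sum_univ_one, intClass]
  induction hx using AddSubgroup.closure_induction_left with
  | zero =>
    refine ⟨Fin 0, inferInstance, inferInstance, Matrix.diagonal fun _ => 0,
      Matrix.isSymm_diagonal _, ?_, ?_⟩
    · rw [Matrix.det_isEmpty]
      exact fun h => (Nat.prime_iff_prime_int.1 hp).not_dvd_one h
    · rw [ofGram_map_diagonal fun i => i.elim0, Fin.sum_univ_zero]
  | add_left x hx y _ ih =>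
    obtain ⟨u, hu, rfl⟩ := hx
    exact hstep u y hu ih
  | neg_add_cancel x hx y _ ih =>
    obtain ⟨u, hu, rfl⟩ := hx
    rw [← intClass_neg]
    exact hstep (-u) y hu.neg ih

theorem ofGram_map_add_ne_zero {p : ℕ} [hp : Fact p.Prime] {G : Matrix ι ι ℤ} (hs : G.IsSymm)
    (hd : ¬ (p : ℤ) ∣ G.det) {s : WittGroup ℚ} (hsm : s ∈ smoothSubgroup p) {n : ℕ} [NeZero n]
    {w : Fin n → ℤ} (hw : ∀ x : Fin n → ℤ, (p : ℤ) ∣ ∑ k, w k * x k ^ 2 → ∀ k, (p : ℤ) ∣ x k) :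
    ofGram (G.map (Int.cast : ℤ → ℚ)) + s + ∑ k, intClass (p * w k) ≠ 0 := by
  obtain ⟨κ, _, _, H, hHs, hHd, rfl⟩ := exists_ofGram_of_mem hp.out hsm
  have hw0 : ∀ k, w k ≠ 0 := by
    intro k hk
    have := hw (Pi.single k 1) (by
      rw [Finset.sum_eq_zero]
      · exact dvd_zero _
      · intro j _
        rcases eq_or_ne j k with rfl | hj
        · rw [hk, zero_mul]
        · rw [Pi.single_eq_of_ne hj]; ring) k
    rw [Pi.single_eq_same] at this
    exact (Nat.prime_iff_prime_int.1 hp.out).not_dvd_one this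
  have hpw : ∀ k, (p : ℤ) * w k ≠ 0 :=
    fun k => mul_ne_zero (by exact_mod_cast hp.out.ne_zero) (hw0 k)
  have hG : G.IsSymm ∧ G.det ≠ 0 := ⟨hs, fun h => hd (h ▸ dvd_zero _)⟩
  have hH : H.IsSymm ∧ H.det ≠ 0 := ⟨hHs, fun h => hHd (h ▸ dvd_zero _)⟩
  have hGHd : ¬ (p : ℤ) ∣ (Matrix.fromBlocks G 0 0 H).det := by
    rw [Matrix.det_fromBlocks_zero₂₁, (Nat.prime_iff_prime_int.1 hp.out).dvd_mul]
    exact not_or.2 ⟨hd, hHd⟩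
  have hGH : (Matrix.fromBlocks G 0 0 H).IsSymm ∧ (Matrix.fromBlocks G 0 0 H).det ≠ 0 :=
    ⟨hs.fromBlocks (by simp) hHs, fun h => hGHd (h ▸ dvd_zero _)⟩
  have hD := int_diagonal_isSymm_det hpw
  have hT : (Matrix.fromBlocks (Matrix.fromBlocks G 0 0 H) 0 0
      (Matrix.diagonal fun k => (p : ℤ) * w k)).IsSymm ∧
      (Matrix.fromBlocks (Matrix.fromBlocks G 0 0 H) 0 0
      (Matrix.diagonal fun k => (p : ℤ) * w k)).det ≠ 0 :=
    ⟨hGH.1.fromBlocks (by simp) hD.1, by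
      rw [Matrix.det_fromBlocks_zero₂₁]
      exact mul_ne_zero hGH.2 hD.2⟩
  intro h
  refine not_isMetabolic_fromBlocks p hGHd hw
    ((ofGram_eq_zero (map_intCast_isSymm_det hT ℚ)).1 ?_)
  rw [ofGram_map_fromBlocks hGH hD, ofGram_map_fromBlocks hG hH, ofGram_map_diagonal hpw]
  exact h

theorem smoothSubgroup_descent {G : Matrix ι ι ℤ} (hs : G.IsSymm) (hd : IsUnit G.det) (N : ℕ)
    (h : ofGram (G.map (Int.cast : ℤ → ℚ)) ∈ smoothSubgroup N) :
    ofGram (G.map (Int.cast : ℤ → ℚ)) ∈ smoothSubgroup 0 := by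
  induction N with
  | zero => exact h
  | succ p ih =>
    refine ih ?_
    by_cases hp : p.Prime
    · have : Fact p.Prime := ⟨hp⟩
      have hdp : ¬ (p : ℤ) ∣ G.det :=
        fun h => (Nat.prime_iff_prime_int.1 hp).not_isUnit (isUnit_of_dvd_unit h hd)
      rcases mk_eq_residueClass h with h0 | ⟨z, hz, h0⟩ | ⟨z, w, hzw, h0⟩
      · exact (QuotientAddGroup.eq_zero_iff _).1 h0
      · rw [residueClass, QuotientAddGroup.eq] at h0
        refine absurd ?_ (ofGram_map_add_ne_zero (n := 1) (w := ![-z.val]) hs hdp h0 ?_)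
        · simp [intClass_neg]
        · intro x hx k
          rw [Subsingleton.elim k 0]
          rw [Fin.sum_univ_one, ← ZMod.intCast_zmod_eq_zero_iff_dvd] at hx
          rw [← ZMod.intCast_zmod_eq_zero_iff_dvd]
          simpa [hz] using hx
      · rw [residueClass, residueClass, ← QuotientAddGroup.mk_add, QuotientAddGroup.eq] at h0
        refine absurd ?_ (ofGram_map_add_ne_zero (n := 2) (w := ![-z.val, -w.val]) hs hdp h0 ?_)
        · simp [intClass_neg, Fin.sum_univ_two]
          abel
        · intro x hx
          rw [Fin.sum_univ_two, ← ZMod.intCast_zmod_eq_zero_iff_dvd] at hx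
          have := hzw (x 0) (x 1) (by
            simp at hx
            linear_combination -hx)
          simp only [Fin.forall_fin_two, ← ZMod.intCast_zmod_eq_zero_iff_dvd]
          exact this
    · refine AddSubgroup.closure_mono ?_ h
      rintro _ ⟨u, hu, rfl⟩
      refine ⟨u, ⟨hu.1, fun q hq hqu => ?_⟩, rfl⟩
      have := hu.2 q hq hqu
      have : q ≠ p := fun h => hp (h ▸ hq)
      omega

theorem exists_ofGram_eq_zsmul {G : Matrix ι ι ℤ} (hs : G.IsSymm) (hd : IsUnit G.det) :
    ∃ k : ℤ, ofGram (G.map (Int.cast : ℤ → ℚ)) = k • intClass 1 := by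
  obtain ⟨n, a, ha, h⟩ := exists_ofGram_eq_sum (map_intCast_isSymm_det ⟨hs, hd.ne_zero⟩ ℚ)
  have hmem : ofGram (G.map (Int.cast : ℤ → ℚ)) ∈ smoothSubgroup (∑ i, (a i).natAbs + 1) := by
    rw [h]
    refine sum_mem fun i _ => intClass_mem (IsSmooth.of_abs_lt (ha i) ?_)
    have := Finset.single_le_sum (f := fun i => (a i).natAbs) (fun _ _ => Nat.zero_le _)
      (Finset.mem_univ i)
    rw [Int.abs_eq_natAbs]
    exact Nat.cast_lt.2 (Nat.lt_succ_of_le this)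
  have hle : smoothSubgroup 0 ≤ AddSubgroup.zmultiples (intClass 1) := by
    refine (AddSubgroup.closure_le _).2 ?_
    rintro _ ⟨u, hu, rfl⟩
    have hu1 : u.natAbs = 1 := by
      by_contra hne
      obtain ⟨q, hq, hqu⟩ := Nat.exists_prime_and_dvd hne
      exact Nat.not_lt_zero q (hu.2 q hq (Int.natCast_dvd.2 hqu))
    rcases Int.natAbs_eq u with h | h <;> rw [h, hu1]
    · exact AddSubgroup.mem_zmultiples _
    · rw [intClass_neg]
      exact neg_mem (AddSubgroup.mem_zmultiples _)
  obtain ⟨k, hk⟩ := AddSubgroup.mem_zmultiples_iff.1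
    (hle (smoothSubgroup_descent hs hd _ hmem))
  exact ⟨k, hk.symm⟩

theorem nsmul_rankOne_real_ne_zero {n : ℕ} (hn : n ≠ 0) {ε : ℝ} (hε : ε ≠ 0) :
    n • rankOne ε ≠ 0 := by
  intro h
  have hsum := ofGram_diagonal (w := fun _ : Fin n => ε) fun _ => hε
  rw [Finset.sum_const, Finset.card_univ, Fintype.card_fin, h,
    ofGram_eq_zero (diagonal_isSymm_det fun _ => hε)] at hsum
  obtain ⟨U, hU, hd⟩ := hsum
  have hbot : U = ⊥ := by
    refine (Submodule.eq_bot_iff _).2 fun x hx => ?_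
    have h1 := hU x hx x hx
    have h2 : ε * ∑ i, x i ^ 2 = 0 := by
      rw [← h1, Matrix.toBilin'_apply', dotProduct, Finset.mul_sum]
      refine Finset.sum_congr rfl fun i _ => ?_
      rw [Matrix.mulVec_diagonal]
      ring
    have h3 := (mul_eq_zero.1 h2).resolve_left hε
    rw [Finset.sum_eq_zero_iff_of_nonneg fun i _ => sq_nonneg (x i)] at h3
    exact funext fun i => pow_eq_zero_iff two_ne_zero |>.1 (h3 i (Finset.mem_univ i))
  rw [hbot, finrank_bot, Module.finrank_fin_fun] at hd
  omega

/-- A unimodular integral form whose real Witt class vanishes is metabolic over `ℚ`. -/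
theorem isMetabolic_of_real {G : Matrix ι ι ℤ} (hs : G.IsSymm) (hd : IsUnit G.det)
    (h : ofGram (G.map (Int.cast : ℤ → ℝ)) = 0) :
    IsMetabolic (Matrix.toBilin' (G.map (Int.cast : ℤ → ℚ))) := by
  have hG : G.IsSymm ∧ G.det ≠ 0 := ⟨hs, hd.ne_zero⟩
  obtain ⟨k, hk⟩ := exists_ofGram_eq_zsmul hs hd
  have key : ∀ (ε : ℤ) (m : ℕ), ε ≠ 0 →
      ofGram (G.map (Int.cast : ℤ → ℚ)) + m • intClass ε = 0 → m = 0 := by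
    intro ε m hε h0
    by_contra hm
    have hD := int_diagonal_isSymm_det (w := fun _ : Fin m => ε) fun _ => hε
    have hT : (Matrix.fromBlocks G 0 0 (Matrix.diagonal fun _ : Fin m => ε)).IsSymm ∧
        (Matrix.fromBlocks G 0 0 (Matrix.diagonal fun _ : Fin m => ε)).det ≠ 0 :=
      ⟨hs.fromBlocks (by simp) hD.1, by
        rw [Matrix.det_fromBlocks_zero₂₁]
        exact mul_ne_zero hG.2 hD.2⟩
    have h1 := ofGram_map_eq_zero hT (by
      rw [ofGram_map_fromBlocks hG hD, ofGram_map_diagonal fun _ => hε, Finset.sum_const,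
        Finset.card_univ, Fintype.card_fin]
      exact h0) ℝ
    rw [ofGram_map_fromBlocks hG hD, ofGram_map_diagonal fun _ => hε, Finset.sum_const,
      Finset.card_univ, Fintype.card_fin, h, zero_add] at h1
    exact nsmul_rankOne_real_ne_zero hm (by exact_mod_cast hε) h1
  rw [← ofGram_eq_zero (map_intCast_isSymm_det hG ℚ), hk]
  obtain ⟨m, rfl | rfl⟩ := k.eq_nat_or_neg
  · have := key (-1) m (by norm_num) (by rw [hk, intClass_neg, natCast_zsmul, smul_neg,
      add_neg_cancel])
    rw [this, Nat.cast_zero, zero_smul]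
  · have := key 1 m one_ne_zero (by rw [hk, neg_smul, natCast_zsmul, neg_add_cancel])
    rw [this, Nat.cast_zero, neg_zero, zero_smul]

end Descent

section Lattice

open Module

variable {m : Type} [Fintype m] [DecidableEq m]

theorem exists_eq_add_transpose {n : ℕ} {S : Matrix (Fin n) (Fin n) ℤ} (hS : S.IsSymm)
    (he : ∀ i, Even (S i i)) : ∃ T : Matrix (Fin n) (Fin n) ℤ, S = T + Tᵀ := by
  choose d hd using he
  refine ⟨Matrix.of fun i j => if i < j then S i j else if i = j then d i else 0, ?_⟩
  ext i j
  rw [Matrix.add_apply, Matrix.transpose_apply, Matrix.of_apply, Matrix.of_apply]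
  rcases lt_trichotomy i j with h | rfl | h
  · simp [h, h.not_gt, h.ne']
  · simp [hd]
  · simp [h, h.not_gt, h.ne', hS.apply]

theorem exists_congr_hyperbolic {A S T : Matrix m m ℤ} (hS : S = T + Tᵀ)
    (hd : IsUnit (Matrix.fromBlocks 0 A Aᵀ S).det) :
    ∃ R : Matrix (m ⊕ m) (m ⊕ m) ℤ,
      Rᵀ * Matrix.fromBlocks 0 A Aᵀ S * R = Matrix.fromBlocks 0 1 1 0 := by
  obtain ⟨Z, hZ⟩ : ∃ Z, A * Z = 1 := by
    have h := Matrix.mul_nonsing_inv _ hd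
    rw [← Matrix.fromBlocks_toBlocks (Matrix.fromBlocks 0 A Aᵀ S)⁻¹, Matrix.fromBlocks_multiply,
      ← Matrix.fromBlocks_one, Matrix.fromBlocks_inj, zero_mul, zero_add] at h
    exact ⟨_, h.1⟩
  have hZ' : Zᵀ * Aᵀ = 1 := by rw [← Matrix.transpose_mul, hZ, Matrix.transpose_one]
  refine ⟨Matrix.fromBlocks 1 (-(Zᵀ * T * Z)) 0 Z, ?_⟩
  rw [Matrix.fromBlocks_transpose, Matrix.fromBlocks_multiply, Matrix.fromBlocks_multiply,
    Matrix.fromBlocks_inj, hS]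
  refine ⟨by simp, by simp [hZ], by simp [hZ'], ?_⟩
  simp only [Matrix.transpose_neg, Matrix.transpose_mul, Matrix.transpose_transpose, mul_zero,
    zero_add, add_mul, mul_add, hZ', mul_neg, neg_mul, one_mul, Matrix.mul_assoc, hZ, mul_one]
  abel

theorem isUnit_det_fromBlocks_zero_one :
    IsUnit (Matrix.fromBlocks 0 1 1 0 : Matrix (m ⊕ m) (m ⊕ m) ℤ).det := by
  refine IsUnit.of_mul_eq_one (Matrix.fromBlocks 0 1 1 0 : Matrix (m ⊕ m) (m ⊕ m) ℤ).det ?_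
  rw [← Matrix.det_mul, Matrix.fromBlocks_multiply]
  simp

/-- The equivalence pairing `2 * k` with the first and `2 * k + 1` with the second copy of `k`. -/
theorem exists_equiv_submatrix_hyperbolicSum (n : ℕ) : ∃ e : Fin n ⊕ Fin n ≃ Fin (2 * n),
    (hyperbolicSum n).submatrix e e = Matrix.fromBlocks 0 1 1 0 := by
  let f : Fin n ⊕ Fin n → Fin (2 * n) :=
    Sum.elim (fun k => ⟨2 * k, by omega⟩) (fun k => ⟨2 * k + 1, by omega⟩)
  have hf : Function.Bijective f := by
    refine (Fintype.bijective_iff_injective_and_card f).2 ⟨?_, by simp [two_mul]⟩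
    rintro (i | i) (j | j) h <;> simp [f, Fin.ext_iff] at h ⊢ <;> omega
  refine ⟨Equiv.ofBijective f hf, ?_⟩
  ext i j
  rcases i with i | i <;> rcases j with j | j <;>
    simp [f, hyperbolicSum, Matrix.one_apply, Fin.ext_iff] <;> grind

theorem exists_equiv_inl {n : ℕ} {g : Fin n → Fin (2 * n)} (hg : Function.Injective g) :
    ∃ e : Fin n ⊕ Fin n ≃ Fin (2 * n), ∀ i, e (Sum.inl i) = g i := by
  classical
  have hc : Fintype.card ↥(Set.range g)ᶜ = n := by
    rw [Fintype.card_compl_set, Set.card_range_of_injective hg, Fintype.card_fin, Fintype.card_fin]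
    omega
  exact ⟨(Equiv.sumCongr (Equiv.ofInjective g hg) (Fintype.equivFinOfCardEq hc).symm).trans
    (Equiv.Set.sumCompl (Set.range g)), fun i => rfl⟩

theorem exists_congr_hyperbolicSum {n : ℕ} {M : Matrix (Fin (2 * n)) (Fin (2 * n)) ℤ}
    (hsym : M.IsSymm) (huni : IsUnit M.det) (heven : ∀ x : Fin (2 * n) → ℤ, Even (x ⬝ᵥ M *ᵥ x))
    (hmet : IsMetabolic (Matrix.toBilin' (M.map (Int.cast : ℤ → ℚ)))) :
    ∃ Q : Matrix (Fin (2 * n)) (Fin (2 * n)) ℤ, IsUnit Q.det ∧ Qᵀ * M * Q = hyperbolicSum n := by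
  obtain ⟨b, r, f, hr, hf⟩ := exists_basis_of_isMetabolic hmet
  rw [Fintype.card_fin] at hr
  obtain ⟨σ, hσ⟩ := exists_equiv_inl
    (f.injective.comp (Fin.castLE_injective (show n ≤ r by omega)))
  obtain ⟨τ, hτ⟩ := exists_equiv_submatrix_hyperbolicSum n
  set B : Matrix (Fin (2 * n)) (Fin (2 * n)) ℤ := (Pi.basisFun ℤ _).toMatrix b with hB
  have hBd : IsUnit B.det := by
    rw [hB, ← Basis.det_apply]
    exact (Pi.basisFun ℤ _).isUnit_det b
  set N : Matrix (Fin n ⊕ Fin n) (Fin n ⊕ Fin n) ℤ := (Bᵀ * M * B).submatrix σ σ with hN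
  have hNd : IsUnit N.det := by
    rw [hN, Matrix.det_submatrix_equiv_self, Matrix.det_mul, Matrix.det_mul, Matrix.det_transpose]
    exact (hBd.mul huni).mul hBd
  have hNs : N.IsSymm := by
    refine Matrix.IsSymm.submatrix ?_ σ
    rw [Matrix.IsSymm, Matrix.transpose_mul, Matrix.transpose_mul, Matrix.transpose_transpose,
      hsym.eq, Matrix.mul_assoc]
  have hNe : ∀ k l, N k l = b (σ k) ⬝ᵥ M *ᵥ b (σ l) := by
    intro k l
    rw [hN, Matrix.submatrix_apply, Matrix.mul_assoc, Matrix.mul_apply]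
    simp [hB, dotProduct, Matrix.mulVec, Matrix.mul_apply, Basis.toMatrix_apply]
  have hblock : N = Matrix.fromBlocks 0 N.toBlocks₁₂ N.toBlocks₁₂ᵀ N.toBlocks₂₂ := by
    rw [← Matrix.fromBlocks_toBlocks N, Matrix.fromBlocks_inj]
    refine ⟨?_, by simp, ?_, by simp⟩
    · ext i j
      simpa [Matrix.toBlocks₁₁, hNe, hσ] using hf _ _
    · ext i j
      simpa [Matrix.toBlocks₂₁, Matrix.toBlocks₁₂] using hNs.apply _ _
  obtain ⟨T, hT⟩ := exists_eq_add_transpose (S := N.toBlocks₂₂)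
    (by ext i j; exact hNs.apply _ _) (fun i => by
      rw [Matrix.toBlocks₂₂, Matrix.of_apply, hNe]
      exact heven _)
  obtain ⟨R, hR⟩ := exists_congr_hyperbolic hT (hblock ▸ hNd)
  rw [← hblock] at hR
  have hQ : (B * R.submatrix σ.symm τ.symm)ᵀ * M * (B * R.submatrix σ.symm τ.symm) =
      hyperbolicSum n := by
    have h1 : Bᵀ * M * B = N.submatrix σ.symm σ.symm := by simp [hN]
    have h2 : hyperbolicSum n = (Matrix.fromBlocks 0 1 1 0).submatrix τ.symm τ.symm := by
      simp [← hτ]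
    calc _ = (R.submatrix σ.symm τ.symm)ᵀ * (Bᵀ * M * B) * R.submatrix σ.symm τ.symm := by
          simp only [Matrix.transpose_mul, Matrix.mul_assoc]
      _ = _ := by
          rw [h1, h2, ← hR, Matrix.transpose_submatrix, Matrix.submatrix_mul_equiv,
            Matrix.submatrix_mul_equiv]
  refine ⟨_, ?_, hQ⟩
  have hdet : IsUnit (hyperbolicSum n).det := by
    rw [← Matrix.det_submatrix_equiv_self τ, hτ]
    exact isUnit_det_fromBlocks_zero_one
  rw [← hQ, Matrix.det_mul] at hdet
  exact isUnit_of_mul_isUnit_right hdet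

theorem ofGram_diagonal_signature_zero (n : ℕ) :
    WittGroup.ofGram (Matrix.diagonal fun i : Fin (2 * n) => if (i : ℕ) < n then (1 : ℝ) else -1) =
      0 := by
  rw [WittGroup.ofGram_diagonal (fun i => by split_ifs <;> norm_num),
    Fin.sum_univ_eq_sum_range (fun i => WittGroup.rankOne (if i < n then (1 : ℝ) else -1)),
    two_mul, Finset.sum_range_add, ← Finset.sum_add_distrib]
  refine Finset.sum_eq_zero fun i hi => ?_
  rw [if_pos (Finset.mem_range.1 hi), if_neg (by omega), WittGroup.rankOne_neg, add_neg_cancel]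

end Lattice

end WittClassification

/-- **An indefinite even unimodular lattice of signature `0` and rank `2n` is
isomorphic to the orthogonal sum of `n` hyperbolic planes.**  Let `M` be the Gram
matrix of an even unimodular symmetric bilinear form of rank `2n` which is indefinite
and has signature `0` (over `ℝ` it diagonalizes with `n` positive and `n` negative
eigenvalues).  Then `M` is integrally congruent to `n ⟂ H`, i.e. there is a change of
basis `Q ∈ GL_{2n}(ℤ)` with `Qᵀ M Q` the hyperbolic Gram matrix. -/
theorem indefinite_even_unimodular_signature_zero
    (n : ℕ) (hn : 1 ≤ n) (M : Matrix (Fin (2 * n)) (Fin (2 * n)) ℤ)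
    (hsym : M.IsSymm)
    (huni : M.det = 1 ∨ M.det = -1)
    (heven : ∀ x : Fin (2 * n) → ℤ, Even (x ⬝ᵥ M.mulVec x))
    (hindef : (∃ x : Fin (2 * n) → ℤ, 0 < x ⬝ᵥ M.mulVec x) ∧
      (∃ y : Fin (2 * n) → ℤ, y ⬝ᵥ M.mulVec y < 0))
    (P : Matrix (Fin (2 * n)) (Fin (2 * n)) ℝ) (hP : IsUnit P.det)
    (hdiag : P.transpose * (M.map (Int.cast : ℤ → ℝ)) * P =
      Matrix.diagonal (fun i : Fin (2 * n) => if (i : ℕ) < n then (1 : ℝ) else -1)) :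
    ∃ Q : Matrix (Fin (2 * n)) (Fin (2 * n)) ℤ,
      (Q.det = 1 ∨ Q.det = -1) ∧ Q.transpose * M * Q = hyperbolicSum n := by
  have hd : IsUnit M.det := Int.isUnit_iff.2 huni
  have h0 := WittClassification.WittGroup.ofGram_congr
    (WittClassification.map_intCast_isSymm_det ⟨hsym, hd.ne_zero⟩ ℝ) hP.ne_zero
  rw [hdiag, WittClassification.ofGram_diagonal_signature_zero] at h0
  obtain ⟨Q, hQ, h⟩ := WittClassification.exists_congr_hyperbolicSum hsym hd heven
    (WittClassification.isMetabolic_of_real hsym hd h0.symm)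
  exact ⟨Q, Int.isUnit_iff.1 hQ, h⟩
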